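/- arXiv:math/0502368 — 2 statements merged into one kernel-verified Lean document; each statement's English description precedes it below -/
import Mathlib

section
/- Let s ≥ 1 and let c be an integer-valued function defined on pairs (v, w) of elements of ℤ^s with v ≤ w (componentwise partial order) satisfying c(v, v) = 0 for all v, and the additivity (cocycle) property c(v, u) = c(v, w) + c(w, u) whenever v ≤ w ≤ u in ℤ^s. Define h(v) = c(v, v + 1̲), where 1̲ = (1, …, 1), and k(v) = − ∑_{I ⊆ {1,…,s}} (−1)^{|I|} · c(v, v + 1̲_I), where 1̲_I ∈ ℤ^s is the indicator vector of the subset I. Then for every v ∈ ℤ^s one has k(v − 1̲) − k(v) = ∑_{I ⊆ {1,…,s}} (−1)^{|I|} · h(v − 1̲ + 1̲_I). -/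
/-- Indicator vector of a subset `I ⊆ {1,…,s}`, as an element of `ℤ^s`. -/
def indicator {s : ℕ} (I : Finset (Fin s)) : Fin s → ℤ :=
  fun i => if i ∈ I then 1 else 0

theorem indicator_nonneg {s : ℕ} (I : Finset (Fin s)) : 0 ≤ indicator I := by
  intro i
  simp only [indicator, Pi.zero_apply]
  split_ifs <;> norm_num

/-- Lemma 2 (combinatorial form): for an additive "Euler characteristic" function `c`
on pairs `v ≤ w` in `ℤ^s`, with `h v = c v (v+1̲)` and
`k v = -∑_{I} (-1)^{|I|} c v (v + 1̲_I)`, one has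
`k (v-1̲) - k v = ∑_I (-1)^{|I|} h (v - 1̲ + 1̲_I)`. -/
theorem stmt0 (s : ℕ) (hs : 1 ≤ s)
    (c : (Fin s → ℤ) → (Fin s → ℤ) → ℤ)
    (hc0 : ∀ v : Fin s → ℤ, c v v = 0)
    (hcadd : ∀ v w u : Fin s → ℤ, v ≤ w → w ≤ u → c v u = c v w + c w u)
    (h k : (Fin s → ℤ) → ℤ)
    (hh : ∀ v : Fin s → ℤ, h v = c v (v + 1))
    (hk : ∀ v : Fin s → ℤ,
      k v = -∑ I : Finset (Fin s), (-1 : ℤ) ^ I.card * c v (v + indicator I))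
    (v : Fin s → ℤ) :
    k (v - 1) - k v
      = ∑ I : Finset (Fin s), (-1 : ℤ) ^ I.card * h (v - 1 + indicator I) := by
  have : Nonempty (Fin s) := ⟨⟨0, hs⟩⟩
  have alternating : ∑ I : Finset (Fin s), (-1 : ℤ) ^ I.card = 0 := by
    rw [← Finset.powerset_univ]
    exact Finset.sum_powerset_neg_one_pow_card_of_nonempty Finset.univ_nonempty
  have key (I : Finset (Fin s)) : h (v - 1 + indicator I) =
      c (v - 1) v + c v (v + indicator I) - c (v - 1) (v - 1 + indicator I) := by
    have hI := indicator_nonneg I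
    have hle : v - 1 ≤ v := sub_le_self v zero_le_one
    have via_lower := hcadd (v - 1) (v - 1 + indicator I) (v + indicator I)
      (le_add_of_nonneg_right hI) (add_le_add_left hle _)
    have via_upper := hcadd (v - 1) v (v + indicator I) hle (le_add_of_nonneg_right hI)
    have shift : v - 1 + indicator I + 1 = v + indicator I := by abel
    rw [hh, shift]
    linarith
  simp only [hk, key, mul_sub, mul_add, Finset.sum_sub_distrib, Finset.sum_add_distrib,
    ← Finset.sum_mul, alternating]
  ring
end

section
/- Let T be a tree on the vertex set {1, …, s}, s ≥ 1. For I ⊆ {1,…,s} and i ∈ I let m_i^I be the number of vertices j ∈ I adjacent to i; let deg(i) be the degree of vertex i, χ_i = 2 − deg(i), and let ζ_i = 1 if vertex i is adjacent to every other vertex of T and ζ_i = 0 otherwise. Then for any nonnegative integers a_1, …, a_s and any rational numbers u_1, …, u_s, −∑_{i=1}^s ∑_{I : i ∈ I ⊆ {1,…,s}, a_i + 1 − m_i^I > 0} (−1)^{|I|} · u_i = ∑_{i=1}^s ζ_i · u_i · (−1)^{a_i} · C(1 − χ_i, a_i), where C(c, a) = c(c−1)⋯(c−a+1)/a! is the generalized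 binomial coefficient for c ∈ ℤ and a ∈ ℕ. -/
open scoped Classical

/-- Generalized binomial coefficient `C(c, a) = c(c-1)⋯(c-a+1)/a!` for `c ∈ ℤ`, `a ∈ ℕ`. -/
noncomputable def genChoose (c : ℤ) (a : ℕ) : ℚ :=
  (∏ j ∈ Finset.range a, ((c : ℚ) - (j : ℚ))) / (Nat.factorial a : ℚ)

/-- The number of vertices `j ∈ I` adjacent to `i` in `G`. -/
noncomputable def adjIn {s : ℕ} (G : SimpleGraph (Fin s)) (I : Finset (Fin s))
    (i : Fin s) : ℕ :=
  (I.filter (fun j => G.Adj i j)).card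

/-- `ζ_i = 1` if the vertex `i` is adjacent to every other vertex, `0` otherwise. -/
noncomputable def zeta {s : ℕ} (G : SimpleGraph (Fin s)) (i : Fin s) : ℚ :=
  if ∀ j : Fin s, j ≠ i → G.Adj i j then 1 else 0

open Finset

theorem genChoose_eq_choose (c : ℤ) (a : ℕ) : genChoose c a = Ring.choose (c : ℚ) a := by
  rw [Ring.choose_eq_smul, ← Polynomial.aeval_eq_smeval, Polynomial.aeval_def,
    Polynomial.eval₂_eq_eval_map, descPochhammer_map, descPochhammer_eval_eq_prod_range, genChoose,
    smul_eq_mul, div_eq_inv_mul]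

/-- Partial alternating sums of binomial coefficients, including the case `n = 0`. -/
theorem alternating_sum_range_choose_eq_genChoose (n a : ℕ) :
    ∑ m ∈ range (a + 1), (-1 : ℚ) ^ m * (n.choose m : ℚ) =
      (-1) ^ a * genChoose ((n : ℤ) - 1) a := by
  induction a with
  | zero => simp [genChoose]
  | succ a ih =>
    have pascal := Ring.choose_succ_succ ((n : ℚ) - 1) a
    rw [sub_add_cancel, Ring.choose_natCast] at pascal
    rw [sum_range_succ, ih, genChoose_eq_choose, genChoose_eq_choose, pascal]
    push_cast
    ring

/-- Truncated alternating sums over the subsets of a finite set, by size. -/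
theorem sum_powerset_ite_card_le {α : Type*} (t : Finset α) (a : ℕ) :
    ∑ J ∈ t.powerset, (if #J ≤ a then (-1 : ℚ) ^ #J else 0) =
      (-1) ^ a * genChoose ((#t : ℤ) - 1) a := by
  rw [sum_powerset_apply_card (fun m => if m ≤ a then (-1 : ℚ) ^ m else 0),
    ← alternating_sum_range_choose_eq_genChoose]
  have h : ∀ m, (#t).choose m • (if m ≤ a then (-1 : ℚ) ^ m else 0) =
      if m ≤ a then (-1 : ℚ) ^ m * ((#t).choose m : ℚ) else 0 := by
    intro m
    split_ifs <;> simp [mul_comm]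
  simp_rw [h, ← sum_filter]
  refine sum_subset_zero_on_sdiff (fun m hm => ?_) (fun m hm => ?_) (fun _ _ => rfl)
  · simp only [mem_filter, mem_range] at hm ⊢
    omega
  · simp only [mem_sdiff, mem_filter, mem_range, not_and] at hm
    rw [Nat.choose_eq_zero_of_lt (by omega)]
    simp

theorem adjIn_insert_of_not_adj {s : ℕ} (G : SimpleGraph (Fin s)) (I : Finset (Fin s))
    {i k : Fin s} (h : ¬ G.Adj i k) : adjIn G (insert k I) i = adjIn G I i := by
  simp [adjIn, filter_insert, h]

/-- The signed count of the sets `I ∋ i` with at most `a` neighbours of `i`. -/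
theorem neg_sum_neg_one_pow_card_eq {s : ℕ} (G : SimpleGraph (Fin s)) (i : Fin s) (a : ℕ) :
    -∑ I ∈ (univ : Finset (Finset (Fin s))).filter
        (fun I => i ∈ I ∧ 0 < (a : ℤ) + 1 - (adjIn G I i : ℤ)), (-1 : ℚ) ^ #I =
      zeta G i * ((-1) ^ a * genChoose ((G.degree i : ℤ) - 1) a) := by
  have reduce : -∑ I ∈ (univ : Finset (Finset (Fin s))).filter
        (fun I => i ∈ I ∧ 0 < (a : ℤ) + 1 - (adjIn G I i : ℤ)), (-1 : ℚ) ^ #I =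
      ∑ J ∈ (univ.erase i).powerset, if adjIn G J i ≤ a then (-1 : ℚ) ^ #J else 0 := by
    rw [sum_filter, ← powerset_univ, ← insert_erase (mem_univ i),
      sum_powerset_insert (notMem_erase i univ), erase_insert (notMem_erase i univ),
      ← sum_add_distrib, ← sum_neg_distrib]
    refine sum_congr rfl fun J hJ => ?_
    have hi : i ∉ J := fun h => notMem_erase i univ (mem_powerset.1 hJ h)
    have hlt : 0 < (a : ℤ) + 1 - (adjIn G J i : ℤ) ↔ adjIn G J i ≤ a := by omega
    simp only [hi, false_and, if_false, mem_insert_self, true_and, zero_add,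
      adjIn_insert_of_not_adj G J (G.irrefl (v := i)), hlt, card_insert_of_notMem hi]
    split_ifs <;> ring
  rw [reduce, zeta]
  split_ifs with hdom
  · have hnbr : G.neighborFinset i = univ.erase i := by
      ext j
      simpa using ⟨fun h => h.ne', hdom j⟩
    rw [one_mul, ← G.card_neighborFinset_eq_degree, hnbr, ← sum_powerset_ite_card_le]
    refine sum_congr rfl fun J hJ => ?_
    have hJ' : adjIn G J i = #J := by
      rw [adjIn, filter_true_of_mem]
      exact fun j hj => hdom j (ne_of_mem_erase (mem_powerset.1 hJ hj))
    rw [hJ']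
  · push Not at hdom
    obtain ⟨k, hki, hk⟩ := hdom
    rw [zero_mul, ← insert_erase (mem_erase.2 ⟨hki, mem_univ k⟩),
      sum_powerset_insert (notMem_erase k _), ← sum_add_distrib]
    refine sum_eq_zero fun J hJ => ?_
    have hkJ : k ∉ J := fun h => notMem_erase k _ (mem_powerset.1 hJ h)
    rw [adjIn_insert_of_not_adj G J hk, card_insert_of_notMem hkJ]
    split_ifs <;> ring

/-- Lemma 10 (combinatorial form): for a tree `T` on `{1,…,s}`, nonnegative integers
`a_i` and rationals `u_i`,
`-∑_i ∑_{I ∋ i, a_i+1-m_i^I>0} (-1)^{|I|} u_i = ∑_i ζ_i u_i (-1)^{a_i} C(1-χ_i, a_i)`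
where `χ_i = 2 - deg(i)`. -/
theorem stmt5 (s : ℕ) (hs : 1 ≤ s) (T : SimpleGraph (Fin s)) (hT : T.IsTree)
    (a : Fin s → ℕ) (u : Fin s → ℚ) :
    -∑ i : Fin s,
        ∑ I ∈ (Finset.univ : Finset (Finset (Fin s))).filter
            (fun I => i ∈ I ∧ 0 < (a i : ℤ) + 1 - (adjIn T I i : ℤ)),
          (-1 : ℚ) ^ I.card * u i
      = ∑ i : Fin s,
          zeta T i * u i * (-1 : ℚ) ^ (a i) *
            genChoose (1 - (2 - (T.degree i : ℤ))) (a i) := by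
  rw [← sum_neg_distrib]
  refine sum_congr rfl fun i _ => ?_
  have hdeg : (1 : ℤ) - (2 - (T.degree i : ℤ)) = (T.degree i : ℤ) - 1 := by ring
  rw [← sum_mul, ← neg_mul, neg_sum_neg_one_pow_card_eq, hdeg]
  ring
end
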